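/- arXiv:1412.8259 — 2 statements merged into one kernel-verified Lean document; each statement's English description precedes it below -/
import Mathlib

section
/- Let ξ be a real number with ξ > 0, ξ ≠ 1, and |log ξ| < 2π, and let x be a real number. Then for every integer n ≥ 0, ξ^x · B_{n,ξ}(x) + ξ^x · (log ξ) · B_{n+1,ξ}(x)/(n+1) = ∑_{j=n}^∞ B_j(x) · (log ξ)^{j−n}/(j−n)!, where the series on the right-hand side converges. -/
/-- The Bernoulli polynomial `B_n(x)` (with `B_1(0) = -1/2`), evaluated at a real `x`. -/
noncomputable def bernoulliPoly (n : ℕ) (x : ℝ) : ℝ := Polynomial.aeval x (Polynomial.bernoulli n)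

/-- The twisted Bernoulli polynomials `B_{n,ξ}(x)`: `n!` times the `n`-th coefficient of the
formal power series `T · exp(xT) · (ξ · exp(T) - 1)⁻¹` over `ℝ`. -/
noncomputable def twistedBernoulliPoly (ξ x : ℝ) (n : ℕ) : ℝ :=
  (n.factorial : ℝ) * PowerSeries.coeff n
    (PowerSeries.X * PowerSeries.rescale x (PowerSeries.exp ℝ) *
      (ξ • PowerSeries.exp ℝ - 1)⁻¹)

/-- The Taylor series of `f` at `c`, as a formal power series in the local variable. -/
noncomputable def taylorPowerSeries (f : ℂ → ℂ) (c : ℂ) : PowerSeries ℂ :=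
  PowerSeries.mk fun n => iteratedDeriv n f c / (n.factorial : ℂ)

namespace taylorPowerSeries

theorem coeff_eq (f : ℂ → ℂ) (c : ℂ) (n : ℕ) :
    PowerSeries.coeff n (taylorPowerSeries f c) = iteratedDeriv n f c / (n.factorial : ℂ) :=
  PowerSeries.coeff_mk _ _

theorem congr {f g : ℂ → ℂ} {c : ℂ} (h : f =ᶠ[nhds c] g) :
    taylorPowerSeries f c = taylorPowerSeries g c := by
  ext n
  rw [coeff_eq, coeff_eq, h.iteratedDeriv_eq]

theorem mul {f g : ℂ → ℂ} {c : ℂ} (hf : AnalyticAt ℂ f c) (hg : AnalyticAt ℂ g c) :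
    taylorPowerSeries (fun z => f z * g z) c =
      taylorPowerSeries f c * taylorPowerSeries g c := by
  ext n
  rw [PowerSeries.coeff_mul, coeff_eq, iteratedDeriv_fun_mul hf.contDiffAt hg.contDiffAt,
    Finset.Nat.sum_antidiagonal_eq_sum_range_succ_mk, Finset.sum_div]
  refine Finset.sum_congr rfl fun i hi => ?_
  have hi : i ≤ n := Nat.lt_succ_iff.mp (Finset.mem_range.mp hi)
  rw [coeff_eq, coeff_eq, Nat.cast_choose ℂ hi]
  have hn : (n.factorial : ℂ) ≠ 0 := by exact_mod_cast n.factorial_ne_zero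
  field_simp

theorem sub {f g : ℂ → ℂ} {c : ℂ} (hf : AnalyticAt ℂ f c) (hg : AnalyticAt ℂ g c) :
    taylorPowerSeries (fun z => f z - g z) c =
      taylorPowerSeries f c - taylorPowerSeries g c := by
  ext n
  rw [map_sub, coeff_eq, coeff_eq, coeff_eq,
    iteratedDeriv_fun_sub hf.contDiffAt hg.contDiffAt, sub_div]

theorem one (c : ℂ) : taylorPowerSeries (fun _ => 1) c = 1 := by
  ext n
  rw [coeff_eq, iteratedDeriv_const, PowerSeries.coeff_one]
  split_ifs with h <;> simp [h]

theorem id (c : ℂ) : taylorPowerSeries (fun z => z) c = PowerSeries.X + PowerSeries.C c := by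
  ext n
  rw [coeff_eq, map_add, PowerSeries.coeff_X, PowerSeries.coeff_C]
  rcases n with _ | _ | n
  · simp
  · simp
  · have : iteratedDeriv (n + 2) (fun z : ℂ => z) c = 0 := by
      simp [iteratedDeriv_succ']
    simp [this]

theorem exp_const_mul (a c : ℂ) :
    taylorPowerSeries (fun z => Complex.exp (a * z)) c =
      Complex.exp (a * c) • PowerSeries.rescale a (PowerSeries.exp ℂ) := by
  ext n
  rw [coeff_eq, iteratedDeriv_cexp_const_mul]
  simp [PowerSeries.coeff_rescale, PowerSeries.coeff_exp]
  ring

theorem exp (c : ℂ) :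
    taylorPowerSeries Complex.exp c = Complex.exp c • PowerSeries.exp ℂ := by
  simpa using exp_const_mul 1 c

/-- Taylor expansion of the relation `F z * (exp z - 1) = z * exp (a z)`. -/
theorem mul_exp_sub_one {F : ℂ → ℂ} {a c : ℂ} (hF : AnalyticAt ℂ F c)
    (h : ∀ᶠ z in nhds c, F z * (Complex.exp z - 1) = z * Complex.exp (a * z)) :
    taylorPowerSeries F c * (Complex.exp c • PowerSeries.exp ℂ - 1) =
      (PowerSeries.X + PowerSeries.C c) *
        (Complex.exp (a * c) • PowerSeries.rescale a (PowerSeries.exp ℂ)) := by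
  have he : AnalyticAt ℂ Complex.exp c := by fun_prop
  rw [← exp, ← one c, ← sub he analyticAt_const, ← mul hF (by fun_prop), ← id,
    ← exp_const_mul, ← mul (by fun_prop) (by fun_prop)]
  exact congr h

end taylorPowerSeries

theorem DifferentiableOn.iteratedDeriv_of_isOpen {f : ℂ → ℂ} {s : Set ℂ}
    (hf : DifferentiableOn ℂ f s) (hs : IsOpen s) (n : ℕ) :
    DifferentiableOn ℂ (iteratedDeriv n f) s := by
  induction n with
  | zero => simpa using hf
  | succ n ih =>
    rw [iteratedDeriv_succ]
    exact ih.deriv hs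

theorem iteratedDeriv_iteratedDeriv_eq_add (f : ℂ → ℂ) (n k : ℕ) :
    iteratedDeriv k (iteratedDeriv n f) = iteratedDeriv (n + k) f := by
  simp only [iteratedDeriv_eq_iterate]
  rw [add_comm n k, Function.iterate_add_apply]

/-- The derivatives of a holomorphic function expand into power series whose coefficients are
the higher derivatives at the centre. -/
theorem DifferentiableOn.hasSum_iteratedDeriv_on_ball {f : ℂ → ℂ} {c z : ℂ} {r : ℝ}
    (hf : DifferentiableOn ℂ f (Metric.ball c r)) (hz : z ∈ Metric.ball c r) (n : ℕ) :
    HasSum (fun k : ℕ => iteratedDeriv (n + k) f c * (z - c) ^ k / (k.factorial : ℂ))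
      (iteratedDeriv n f z) := by
  convert! Complex.hasSum_taylorSeries_on_ball
    (hf.iteratedDeriv_of_isOpen Metric.isOpen_ball n) hz using 2 with k
  rw [iteratedDeriv_iteratedDeriv_eq_add, smul_eq_mul, smul_eq_mul]
  ring

theorem Complex.exp_ne_one_of_norm_lt_two_pi {z : ℂ} (hz : ‖z‖ < 2 * Real.pi) (h0 : z ≠ 0) :
    Complex.exp z ≠ 1 := by
  intro h
  obtain ⟨m, rfl⟩ := Complex.exp_eq_one_iff.mp h
  have hm : m ≠ 0 := by
    rintro rfl
    simp at h0
  have h1 : (1 : ℝ) ≤ |(m : ℝ)| := by exact_mod_cast Int.one_le_abs hm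
  have h2 : ‖(m : ℂ) * (2 * Real.pi * Complex.I)‖ = |(m : ℝ)| * (2 * Real.pi) := by
    simp [abs_of_pos Real.pi_pos]
  rw [h2] at hz
  nlinarith [Real.pi_pos]

/-- `z * exp (a z) / (exp z - 1)` extends holomorphically to the disc of radius `2π`. -/
theorem exists_differentiableOn_mul_exp_sub_one (a : ℂ) :
    ∃ F : ℂ → ℂ, DifferentiableOn ℂ F (Metric.ball 0 (2 * Real.pi)) ∧
      ∀ z ∈ Metric.ball (0 : ℂ) (2 * Real.pi),
        F z * (Complex.exp z - 1) = z * Complex.exp (a * z) := by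
  have hslope (z : ℂ) : z * dslope Complex.exp 0 z = Complex.exp z - 1 := by
    simpa using sub_smul_dslope Complex.exp 0 z
  have hne : ∀ z ∈ Metric.ball (0 : ℂ) (2 * Real.pi), dslope Complex.exp 0 z ≠ 0 := by
    intro z hz h
    rcases eq_or_ne z 0 with rfl | h0
    · simp [dslope_same] at h
    · refine Complex.exp_ne_one_of_norm_lt_two_pi (mem_ball_zero_iff.mp hz) h0 ?_
      rw [← sub_eq_zero, ← hslope, h, mul_zero]
  refine ⟨fun z => Complex.exp (a * z) / dslope Complex.exp 0 z, ?_, fun z hz => ?_⟩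
  · refine DifferentiableOn.div (by fun_prop) ?_ hne
    exact (Complex.differentiableOn_dslope (Metric.ball_mem_nhds 0 (by positivity))).mpr
      Complex.differentiable_exp.differentiableOn
  · rw [← hslope]
    field_simp [hne z hz]

theorem bernoulliPoly_eq_iteratedDeriv {F : ℂ → ℂ} {x : ℝ} (hF : AnalyticAt ℂ F 0)
    (h : ∀ᶠ z in nhds 0, F z * (Complex.exp z - 1) = z * Complex.exp (x * z)) (n : ℕ) :
    (bernoulliPoly n x : ℂ) = iteratedDeriv n F 0 := by
  have h1 := taylorPowerSeries.mul_exp_sub_one hF h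
  have h2 := Polynomial.bernoulli_generating_function (x : ℂ)
  simp only [Complex.exp_zero, one_smul, map_zero, add_zero, mul_zero] at h1
  rw [← h2] at h1
  have hne : PowerSeries.exp ℂ - 1 ≠ 0 := by
    intro h0
    have := congrArg (PowerSeries.coeff 1) h0
    simp [PowerSeries.coeff_exp, PowerSeries.coeff_one] at this
  have h3 := congrArg (PowerSeries.coeff n) (mul_right_cancel₀ hne h1)
  rw [taylorPowerSeries.coeff_eq, PowerSeries.coeff_mk, map_smul, Algebra.smul_def] at h3
  have hn : (n.factorial : ℂ) ≠ 0 := by exact_mod_cast n.factorial_ne_zero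
  have h4 : (bernoulliPoly n x : ℂ) = Polynomial.aeval (x : ℂ) (Polynomial.bernoulli n) :=
    (Polynomial.aeval_algebraMap_apply ℂ x (Polynomial.bernoulli n)).symm
  rw [h4]
  simp at h3
  field_simp at h3
  exact h3.symm

theorem twistedBernoulliPoly_add_eq_iteratedDeriv {F : ℂ → ℂ} {ξ x : ℝ} (hξ0 : 0 < ξ)
    (hξ1 : ξ ≠ 1) (hF : AnalyticAt ℂ F (Real.log ξ))
    (h : ∀ᶠ z in nhds (Real.log ξ : ℂ),
      F z * (Complex.exp z - 1) = z * Complex.exp (x * z)) (n : ℕ) :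
    ((ξ ^ x * twistedBernoulliPoly ξ x n +
        ξ ^ x * Real.log ξ * twistedBernoulliPoly ξ x (n + 1) * (1 / ((n : ℝ) + 1)) : ℝ) : ℂ) =
      iteratedDeriv n F (Real.log ξ) := by
  have h1 := taylorPowerSeries.mul_exp_sub_one hF h
  have hexp : Complex.exp (Real.log ξ : ℂ) = (ξ : ℂ) := by
    rw [← Complex.ofReal_exp, Real.exp_log hξ0]
  have hexp' : Complex.exp (x * Real.log ξ : ℂ) = ((ξ ^ x : ℝ) : ℂ) := by
    rw [← Complex.ofReal_mul, ← Complex.ofReal_exp, Real.rpow_def_of_pos hξ0, mul_comm x]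
  rw [hexp, hexp'] at h1
  have hcoeff : PowerSeries.constantCoeff (ξ • PowerSeries.exp ℝ - 1) ≠ 0 := by
    simpa [PowerSeries.smul_eq_C_mul, sub_eq_zero] using hξ1
  set G : PowerSeries ℝ := PowerSeries.X * PowerSeries.rescale x (PowerSeries.exp ℝ) *
      (ξ • PowerSeries.exp ℝ - 1)⁻¹ with hG
  clear_value G
  have h2 : G * (ξ • PowerSeries.exp ℝ - 1) =
      PowerSeries.X * PowerSeries.rescale x (PowerSeries.exp ℝ) := by
    rw [hG, mul_assoc, PowerSeries.inv_mul_cancel _ hcoeff, mul_one]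
  have h3 := congrArg (PowerSeries.map Complex.ofRealHom) h2
  rw [map_mul, map_mul, map_sub, map_one, PowerSeries.smul_eq_C_mul, map_mul,
    PowerSeries.map_C, PowerSeries.map_exp, PowerSeries.map_X, ← PowerSeries.rescale_map,
    PowerSeries.map_exp, Complex.ofRealHom_eq_coe, Complex.ofRealHom_eq_coe] at h3
  rw [PowerSeries.smul_eq_C_mul, PowerSeries.smul_eq_C_mul] at h1
  have hne : PowerSeries.C (ξ : ℂ) * PowerSeries.exp ℂ - 1 ≠ 0 := by
    intro h0
    have := congrArg PowerSeries.constantCoeff h0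
    simp only [map_sub, map_mul, PowerSeries.constantCoeff_C, PowerSeries.constantCoeff_exp,
      mul_one, map_one, map_zero, sub_eq_zero] at this
    exact hξ1 (by exact_mod_cast this)
  have h4 : PowerSeries.X * taylorPowerSeries F (Real.log ξ) =
      PowerSeries.C ((ξ ^ x : ℝ) : ℂ) * ((PowerSeries.X + PowerSeries.C (Real.log ξ : ℂ)) *
        PowerSeries.map Complex.ofRealHom G) := by
    refine mul_right_cancel₀ hne ?_
    linear_combination PowerSeries.X * h1 - PowerSeries.C ((ξ ^ x : ℝ) : ℂ) *
      (PowerSeries.X + PowerSeries.C (Real.log ξ : ℂ)) * h3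
  have h5 := congrArg (PowerSeries.coeff (n + 1)) h4
  rw [mul_comm PowerSeries.X, PowerSeries.coeff_succ_mul_X, PowerSeries.coeff_C_mul, add_mul,
    map_add, mul_comm PowerSeries.X, PowerSeries.coeff_succ_mul_X, PowerSeries.coeff_C_mul,
    PowerSeries.coeff_map, PowerSeries.coeff_map, taylorPowerSeries.coeff_eq,
    Complex.ofRealHom_eq_coe, Complex.ofRealHom_eq_coe] at h5
  have hn : (n.factorial : ℂ) ≠ 0 := by exact_mod_cast n.factorial_ne_zero
  have hn1 : (n : ℂ) + 1 ≠ 0 := by exact_mod_cast n.succ_ne_zero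
  rw [div_eq_iff hn] at h5
  rw [h5, twistedBernoulliPoly, twistedBernoulliPoly, ← hG, Nat.factorial_succ]
  push_cast
  field_simp

theorem twistedBernoulliPoly_sum_eq_tsum_bernoulliPoly (ξ : ℝ) (hξ0 : 0 < ξ) (hξ1 : ξ ≠ 1)
    (hlog : |Real.log ξ| < 2 * Real.pi) (x : ℝ) (n : ℕ) :
    Summable (fun k : ℕ => bernoulliPoly (n + k) x * (Real.log ξ) ^ k / (k.factorial : ℝ)) ∧
    ξ ^ x * twistedBernoulliPoly ξ x n +
        ξ ^ x * Real.log ξ * twistedBernoulliPoly ξ x (n + 1) * (1 / ((n : ℝ) + 1)) =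
      ∑' k : ℕ, bernoulliPoly (n + k) x * (Real.log ξ) ^ k / (k.factorial : ℝ) := by
  obtain ⟨F, hF, hmul⟩ := exists_differentiableOn_mul_exp_sub_one (x : ℂ)
  have hmem : (Real.log ξ : ℂ) ∈ Metric.ball (0 : ℂ) (2 * Real.pi) := by
    rwa [mem_ball_zero_iff, Complex.norm_real, Real.norm_eq_abs]
  have hnhds {c : ℂ} (hc : c ∈ Metric.ball (0 : ℂ) (2 * Real.pi)) :
      Metric.ball (0 : ℂ) (2 * Real.pi) ∈ nhds c := Metric.isOpen_ball.mem_nhds hc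
  have hzero : (0 : ℂ) ∈ Metric.ball (0 : ℂ) (2 * Real.pi) :=
    Metric.mem_ball_self (by positivity)
  have hsum := hF.hasSum_iteratedDeriv_on_ball hmem n
  rw [← twistedBernoulliPoly_add_eq_iteratedDeriv hξ0 hξ1 (hF.analyticAt (hnhds hmem))
    (Filter.eventually_of_mem (hnhds hmem) hmul) n] at hsum
  simp only [← bernoulliPoly_eq_iteratedDeriv (hF.analyticAt (hnhds hzero))
    (Filter.eventually_of_mem (hnhds hzero) hmul), sub_zero] at hsum
  have hreal : HasSum
      (fun k : ℕ => bernoulliPoly (n + k) x * (Real.log ξ) ^ k / (k.factorial : ℝ))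
      (ξ ^ x * twistedBernoulliPoly ξ x n +
        ξ ^ x * Real.log ξ * twistedBernoulliPoly ξ x (n + 1) * (1 / ((n : ℝ) + 1))) :=
    Complex.hasSum_ofReal.mp (by push_cast at hsum ⊢; exact hsum)
  exact ⟨hreal.summable, hreal.tsum_eq.symm⟩
end

section
/- Let ξ be a real number with ξ > 0, ξ ≠ 1, and |log ξ| < 2π. Then for every integer n ≥ 0, the twisted Bernoulli numbers satisfy B_{n,ξ} + (log ξ)·B_{n+1,ξ}/(n+1) = ∑_{j=n}^∞ B_j · (log ξ)^{j−n}/(j−n)!, where the series on the right-hand side converges. -/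
open Finset in
theorem abs_bernoulli_le (j : ℕ) :
    |(bernoulli j : ℝ)| ≤ 4 * j.factorial / (2 * Real.pi) ^ j := by
  have hpi := Real.pi_pos
  have hpi3 := Real.pi_gt_three
  have hpi4 := Real.pi_le_four
  rcases Nat.even_or_odd j with he | ho
  · obtain ⟨k, rfl⟩ := he.exists_two_nsmul j
    rw [smul_eq_mul]
    rcases Nat.eq_zero_or_pos k with rfl | hk
    · norm_num
    have hz := hasSum_zeta_nat hk.ne'
    have hle := hasSum_le (fun n => ?_) hz hasSum_zeta_two
    · have h0 := hz.nonneg (fun n => by positivity)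
      rw [← abs_of_nonneg h0] at hle
      have h2 : (2 : ℝ) ^ (2 * k) = 2 * 2 ^ (2 * k - 1) := by
        rw [← pow_succ']; congr 1; omega
      rw [abs_div, abs_mul, abs_mul, abs_mul, abs_pow, abs_neg, abs_one, one_pow, one_mul,
        abs_of_pos (by positivity : (0 : ℝ) < 2 ^ (2 * k - 1)),
        abs_of_pos (by positivity : (0 : ℝ) < Real.pi ^ (2 * k)), Nat.abs_cast,
        div_le_iff₀ (by positivity)] at hle
      rw [le_div_iff₀ (by positivity), mul_pow, h2]
      have h6 : Real.pi ^ 2 / 6 ≤ 2 := by nlinarith [Real.pi_lt_d2]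
      have h7 : Real.pi ^ 2 / 6 * ((2 * k).factorial : ℝ) ≤ 2 * (2 * k).factorial := by gcongr
      linarith
    · rcases Nat.eq_zero_or_pos n with rfl | hn
      · simp [hk.ne']
      · have hn' : (1 : ℝ) ≤ n := by exact_mod_cast hn
        exact one_div_le_one_div_of_le (by positivity)
          (pow_le_pow_right₀ hn' (by omega))
  · rcases eq_or_ne j 1 with rfl | hj
    · rw [bernoulli_one]
      norm_num
      rw [le_div_iff₀ (by positivity)]
      linarith
    · rw [bernoulli_eq_zero_of_odd ho (by have := ho.pos; omega)]
      simp only [Rat.cast_zero, abs_zero]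
      positivity

theorem summable_abs_bernoulli_add_mul_pow_div_factorial (n : ℕ) {x : ℝ}
    (hx : |x| < 2 * Real.pi) :
    Summable fun k : ℕ => |(bernoulli (n + k) : ℝ) * x ^ k / (k.factorial : ℝ)| := by
  have hpi := Real.pi_pos
  have hr : ‖|x| / (2 * Real.pi)‖ < 1 := by
    rw [Real.norm_of_nonneg (by positivity), div_lt_one (by positivity)]
    exact hx
  refine .of_nonneg_of_le (fun _ => abs_nonneg _) (fun k => ?_)
    ((summable_choose_mul_geometric_of_norm_lt_one n hr).mul_left
      (4 * n.factorial / (2 * Real.pi) ^ n))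
  rw [abs_div, abs_mul, abs_pow, Nat.abs_cast]
  have hfac : ((n + k).factorial : ℝ) = (k + n).choose n * k.factorial * n.factorial := by
    rw [add_comm n k]
    exact_mod_cast (Nat.add_choose_mul_factorial_mul_factorial k n).symm
  calc |(bernoulli (n + k) : ℝ)| * |x| ^ k / (k.factorial : ℝ)
      ≤ 4 * (n + k).factorial / (2 * Real.pi) ^ (n + k) * |x| ^ k / (k.factorial : ℝ) := by
        gcongr
        exact abs_bernoulli_le _
    _ = _ := by
        rw [hfac, div_pow, pow_add]
        have := Nat.factorial_ne_zero k
        field_simp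

/-- The `n`-th derivative of `x / (exp x - 1)`, as the power series
`∑ B_{n+k} x ^ k / k!`. -/
noncomputable def bernoulliSeries (n : ℕ) (x : ℝ) : ℝ :=
  ∑' k : ℕ, (bernoulli (n + k) : ℝ) * x ^ k / (k.factorial : ℝ)

theorem hasDerivAt_bernoulliSeries (n : ℕ) {x : ℝ} (hx : |x| < 2 * Real.pi) :
    HasDerivAt (bernoulliSeries n) (bernoulliSeries (n + 1) x) x := by
  obtain ⟨r, hxr, hr⟩ := exists_between hx
  have hr0 : 0 ≤ r := (abs_nonneg x).trans hxr.le
  let g' : ℕ → ℝ → ℝ := fun k y => (bernoulli (n + k) : ℝ) * (k * y ^ (k - 1)) / k.factorial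
  have hg'_succ (k : ℕ) (y : ℝ) :
      g' (k + 1) y = (bernoulli (n + 1 + k) : ℝ) * y ^ k / k.factorial := by
    have hk : ((k : ℝ) + 1) ≠ 0 := by positivity
    have hk' : (k.factorial : ℝ) ≠ 0 := by positivity
    simp only [g', Nat.add_sub_cancel, Nat.factorial_succ, Nat.cast_mul, Nat.cast_add,
      Nat.cast_one, show n + (k + 1) = n + 1 + k by ring]
    field_simp
  have hsum' {y : ℝ} (hy : |y| < 2 * Real.pi) : Summable fun k => |g' k y| := by
    rw [← summable_nat_add_iff 1]
    simpa only [hg'_succ] using summable_abs_bernoulli_add_mul_pow_div_factorial (n + 1) hy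
  have key : HasDerivAt (bernoulliSeries n) (∑' k, g' k x) x := by
    refine hasDerivAt_tsum_of_isPreconnected (t := Metric.ball (0 : ℝ) r) (y₀ := x)
      (hsum' (y := r) (by rwa [abs_of_nonneg hr0])) Metric.isOpen_ball
      (convex_ball _ _).isPreconnected (fun k y _ => ?_) (fun k y hy => ?_) (by simpa using hxr)
      (summable_abs_bernoulli_add_mul_pow_div_factorial n hx).of_abs (by simpa using hxr)
    · exact ((hasDerivAt_pow k y).const_mul _).div_const _
    · have hy' : |y| ≤ r := by simpa using (Metric.mem_ball.1 hy).le
      simp only [g', Real.norm_eq_abs, abs_div, abs_mul, abs_pow, Nat.abs_cast,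
        abs_of_nonneg hr0]
      gcongr
  rw [(hsum' hx).of_abs.tsum_eq_zero_add] at key
  rw [bernoulliSeries.eq_def (n + 1)]
  simpa only [hg'_succ, g', Nat.cast_zero, zero_mul, mul_zero, zero_div, zero_add] using key

open Finset in
theorem sum_antidiagonal_bernoulli_div_factorial (m : ℕ) :
    ∑ kl ∈ antidiagonal m, (bernoulli kl.1 : ℝ) / kl.1.factorial * (1 / kl.2.factorial) =
      (if m = 1 then 1 else 0) + (bernoulli m : ℝ) / m.factorial := by
  have h : bernoulliPowerSeries ℝ * PowerSeries.exp ℝ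
      = PowerSeries.X + bernoulliPowerSeries ℝ := by
    rw [← bernoulliPowerSeries_mul_exp_sub_one]; ring
  have h' := congrArg (PowerSeries.coeff m) h
  simpa [PowerSeries.coeff_mul, bernoulliPowerSeries, PowerSeries.coeff_exp,
    PowerSeries.coeff_X] using h'

open Finset in
theorem bernoulliSeries_zero_mul_exp {x : ℝ} (hx : |x| < 2 * Real.pi) :
    bernoulliSeries 0 x * Real.exp x = x + bernoulliSeries 0 x := by
  have hs := (summable_abs_bernoulli_add_mul_pow_div_factorial 0 hx).of_abs
  have he := Real.summable_pow_div_factorial x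
  have hexp : Real.exp x = ∑' k : ℕ, x ^ k / (k.factorial : ℝ) := by
    rw [Real.exp_eq_exp_ℝ, NormedSpace.exp_eq_tsum_div]
  rw [hexp, bernoulliSeries, tsum_mul_tsum_eq_tsum_sum_antidiagonal_of_summable_norm hs.norm he.norm]
  have hterm (m : ℕ) : ∑ kl ∈ antidiagonal m,
      (bernoulli (0 + kl.1) : ℝ) * x ^ kl.1 / kl.1.factorial * (x ^ kl.2 / kl.2.factorial) =
        (if m = 1 then x else 0) + (bernoulli (0 + m) : ℝ) * x ^ m / m.factorial := by
    calc _ = (∑ kl ∈ antidiagonal m,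
          (bernoulli kl.1 : ℝ) / kl.1.factorial * (1 / kl.2.factorial)) * x ^ m := by
          rw [sum_mul]
          refine sum_congr rfl fun kl hkl => ?_
          rw [← mem_antidiagonal.1 hkl, pow_add, zero_add]
          ring
      _ = _ := by
          rw [sum_antidiagonal_bernoulli_div_factorial, zero_add, add_mul]
          congr 1
          · split_ifs with h <;> simp [h]
          · ring
  have hX : HasSum (fun m : ℕ => if m = 1 then x else 0) x := hasSum_ite_eq 1 x
  rw [tsum_congr hterm, hX.summable.tsum_add hs, hX.tsum_eq]

open Finset in
/-- The Leibniz rule applied to `bernoulliSeries 0 x * exp x - bernoulliSeries 0 x = x`. -/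
theorem sum_choose_mul_bernoulliSeries_mul_exp (n : ℕ) {x : ℝ} (hx : |x| < 2 * Real.pi) :
    (∑ ij ∈ antidiagonal n, (n.choose ij.1 : ℝ) * bernoulliSeries ij.1 x) * Real.exp x
      - bernoulliSeries n x = if n = 0 then x else if n = 1 then 1 else 0 := by
  induction n generalizing x with
  | zero => simp [bernoulliSeries_zero_mul_exp hx]
  | succ n ih =>
    have hderiv := (((HasDerivAt.fun_sum fun (ij : ℕ × ℕ) (_ : ij ∈ antidiagonal n) =>
      (hasDerivAt_bernoulliSeries ij.1 hx).const_mul (n.choose ij.1 : ℝ)).mul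
        (Real.hasDerivAt_exp x)).sub (hasDerivAt_bernoulliSeries n hx))
    have hU : ∀ᶠ y in nhds x, |y| < 2 * Real.pi :=
      (isOpen_lt continuous_abs continuous_const).mem_nhds hx
    have hrhs : HasDerivAt (fun y : ℝ => if n = 0 then y else if n = 1 then 1 else 0)
        (if n + 1 = 0 then x else if n + 1 = 1 then 1 else 0) x := by
      rcases eq_or_ne n 0 with rfl | hn
      · simpa using hasDerivAt_id' x
      · simpa [hn] using hasDerivAt_const x (if n = 1 then (1 : ℝ) else 0)
    rw [← hderiv.unique (hrhs.congr_of_eventuallyEq (hU.mono fun y hy => ih hy)),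
      sum_antidiagonal_choose_succ_mul fun i _ => bernoulliSeries i x]
    have hsymm : ∑ ij ∈ antidiagonal n, (n.choose ij.2 : ℝ) * bernoulliSeries (ij.1 + 1) x =
        ∑ ij ∈ antidiagonal n, (n.choose ij.1 : ℝ) * bernoulliSeries (ij.1 + 1) x :=
      sum_congr rfl fun ij hij => by
        rw [Nat.choose_symm_of_eq_add (mem_antidiagonal.1 hij).symm]
    rw [hsymm]
    ring

open Finset in
theorem mk_bernoulliSeries_mul {x : ℝ} (hx : |x| < 2 * Real.pi) :
    PowerSeries.mk (fun n => bernoulliSeries n x / n.factorial) *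
      (Real.exp x • PowerSeries.exp ℝ - 1) = PowerSeries.X + PowerSeries.C x := by
  ext n
  have h := sum_choose_mul_bernoulliSeries_mul_exp n hx
  have hn : (n.factorial : ℝ) ≠ 0 := by positivity
  have hsum : ∑ ij ∈ antidiagonal n,
      bernoulliSeries ij.1 x / ij.1.factorial * (1 / ij.2.factorial) =
        (∑ ij ∈ antidiagonal n, (n.choose ij.1 : ℝ) * bernoulliSeries ij.1 x) / n.factorial := by
    rw [sum_div]
    refine sum_congr rfl fun ij hij => ?_
    obtain rfl := mem_antidiagonal.1 hij
    rw [Nat.cast_add_choose]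
    field_simp
  have hcoeff : PowerSeries.coeff n
      (PowerSeries.mk (fun n => bernoulliSeries n x / n.factorial) * PowerSeries.exp ℝ) =
        ∑ ij ∈ antidiagonal n, bernoulliSeries ij.1 x / ij.1.factorial * (1 / ij.2.factorial) := by
    simp [PowerSeries.coeff_mul, PowerSeries.coeff_exp]
  rw [mul_sub, mul_one, mul_smul_comm, map_sub, map_smul, hcoeff, hsum, PowerSeries.coeff_mk,
    smul_eq_mul, map_add, PowerSeries.coeff_X, PowerSeries.coeff_C]
  calc _ = ((∑ ij ∈ antidiagonal n, (n.choose ij.1 : ℝ) * bernoulliSeries ij.1 x) * Real.exp x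
      - bernoulliSeries n x) / n.factorial := by ring
    _ = _ := by
      rw [h]
      rcases n with _ | _ | n <;> simp


/-- The twisted Bernoulli numbers `B_{n,ξ}`: `n!` times the `n`-th coefficient of the
formal power series `T · (ξ · exp(T) - 1)⁻¹` over `ℝ`. -/
noncomputable def twistedBernoulli (ξ : ℝ) (n : ℕ) : ℝ :=
  (n.factorial : ℝ) * PowerSeries.coeff (R := ℝ) n
    (PowerSeries.X * (ξ • PowerSeries.exp ℝ - 1)⁻¹)

theorem twistedBernoulli_sum_eq_tsum_bernoulli (ξ : ℝ) (hξ0 : 0 < ξ) (hξ1 : ξ ≠ 1)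
    (hlog : |Real.log ξ| < 2 * Real.pi) (n : ℕ) :
    Summable (fun k : ℕ => (bernoulli (n + k) : ℝ) * (Real.log ξ) ^ k / (k.factorial : ℝ)) ∧
    twistedBernoulli ξ n + Real.log ξ * twistedBernoulli ξ (n + 1) * (1 / ((n : ℝ) + 1)) =
      ∑' k : ℕ, (bernoulli (n + k) : ℝ) * (Real.log ξ) ^ k / (k.factorial : ℝ) := by
  refine ⟨(summable_abs_bernoulli_add_mul_pow_div_factorial n hlog).of_abs, ?_⟩
  have hne : PowerSeries.constantCoeff (ξ • PowerSeries.exp ℝ - 1) ≠ 0 := by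
    rw [map_sub, PowerSeries.constantCoeff_smul]
    simpa [sub_eq_zero] using hξ1
  have hmk := mk_bernoulliSeries_mul hlog
  rw [Real.exp_log hξ0, ← PowerSeries.eq_mul_inv_iff_mul_eq hne, add_mul] at hmk
  have hcoeff := congrArg (PowerSeries.coeff n) hmk
  rw [PowerSeries.coeff_mk, map_add, PowerSeries.coeff_C_mul] at hcoeff
  have hn : (n.factorial : ℝ) ≠ 0 := by positivity
  have hn1 : (n : ℝ) + 1 ≠ 0 := by positivity
  rw [div_eq_iff hn] at hcoeff
  rw [← bernoulliSeries, hcoeff, twistedBernoulli, twistedBernoulli, PowerSeries.coeff_succ_X_mul,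
    Nat.factorial_succ]
  push_cast
  field_simp
end
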